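/- The assignment (T,φ) ↦ F(T,φ) is a bijection from OP_Γ onto the set of faces of the Voronoi polytope Vor_Γ, and for (T,φ), (T',φ') ∈ OP_Γ one has (T,φ) ≤ (T',φ') if and only if F(T,φ) ⊇ F(T',φ'); that is, OP_Γ is isomorphic to the poset of faces of Vor_Γ ordered by reverse inclusion. -/

import Mathlib

/-!
Serre-style finite graphs: a vertex type `V`, an oriented-edge type `E` with a
fixed-point-free involution `inv` (edge reversal) and source/target maps `s, t`
with `s (inv e) = t e`.  An unoriented edge is an `inv`-orbit `{e, inv e}`;
subsets of unoriented edges are encoded as `inv`-closed subsets of `E`, and an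
orientation of a spanning subgraph `Γ∖T` is encoded by the set `O` of its
positively oriented edges.  1-chains with coefficients in `A` are encoded as
functions `c : E → A` with `c (inv e) = - c e` (so that `(c, e⃗) = c e` for the
standard bilinear form).
-/

structure SerreGraph where
  V : Type
  E : Type
  [fintypeV : Fintype V]
  [fintypeE : Fintype E]
  [decEqV : DecidableEq V]
  [decEqE : DecidableEq E]
  inv : E → E
  s : E → V
  t : E → V
  inv_inv : ∀ e, inv (inv e) = e
  inv_ne : ∀ e, inv e ≠ e
  s_inv : ∀ e, s (inv e) = t e

attribute [instance] SerreGraph.fintypeV SerreGraph.fintypeE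
attribute [instance] SerreGraph.decEqV SerreGraph.decEqE

namespace SerreGraph

variable (Γ : SerreGraph)

/-- Reachability between vertices in the spanning subgraph whose allowed oriented
edges are those in `A`. -/
def Reach (A : Set Γ.E) : Γ.V → Γ.V → Prop :=
  Relation.ReflTransGen (fun a b => ∃ e ∈ A, Γ.s e = a ∧ Γ.t e = b)

/-- The number of connected components of the spanning subgraph with allowed
oriented edges `A`. -/
noncomputable def numComponents (A : Set Γ.E) : ℕ :=
  Nat.card (Quot (fun a b : Γ.V => ∃ e ∈ A, Γ.s e = a ∧ Γ.t e = b))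

/-- The set of separating (oriented) edges: removing the underlying unoriented
edge increases the number of connected components. -/
def Esep : Set Γ.E :=
  {e | Γ.numComponents Set.univ < Γ.numComponents {f | f ≠ e ∧ f ≠ Γ.inv e}}

/-- `T` encodes a set of unoriented edges. -/
def InvClosed (T : Set Γ.E) : Prop := ∀ e, e ∈ T ↔ Γ.inv e ∈ T

/-- `O` is (the set of positively oriented edges of) an orientation of `Γ∖T`. -/
def IsOrientation (T O : Set Γ.E) : Prop :=
  (∀ e ∈ O, e ∉ T) ∧ ∀ e, e ∉ T → (e ∈ O ↔ Γ.inv e ∉ O)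

/-- A totally cyclic orientation of `Γ∖T`: an orientation such that there is no
vertex set `W` which is nonempty and proper inside some connected component of
`Γ∖T` and such that all edges of `Γ∖T` crossing the boundary of `W` are oriented
out of `W` (this is the componentwise condition of the paper). -/
def IsTotallyCyclic (T O : Set Γ.E) : Prop :=
  Γ.IsOrientation T O ∧
    ¬ ∃ W : Set Γ.V, (∃ v ∈ W, ∃ w ∈ Wᶜ, Γ.Reach Tᶜ v w) ∧
        ∀ e ∈ O, Γ.t e ∈ W → Γ.s e ∈ W

/-- `γ` is (the set of positively oriented edges of) an oriented circuit of `Γ`: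
a cyclic subgraph (connected, first Betti number one, no separating edges)
together with a totally cyclic orientation; equivalently a directed cycle:
each incident vertex has exactly one outgoing and one incoming edge in `γ`,
and the support is connected. -/
def IsCircuit (γ : Finset Γ.E) : Prop :=
  γ.Nonempty ∧ (∀ e ∈ γ, Γ.inv e ∉ γ) ∧
    (∀ v ∈ γ.image Γ.s ∪ γ.image Γ.t, ∃! e, e ∈ γ ∧ Γ.s e = v) ∧
    (∀ v ∈ γ.image Γ.s ∪ γ.image Γ.t, ∃! e, e ∈ γ ∧ Γ.t e = v) ∧
    ∀ e ∈ γ, ∀ f ∈ γ, Γ.Reach ((↑γ : Set Γ.E) ∪ Γ.inv '' ↑γ) (Γ.s e) (Γ.s f)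

/-- The class `[γ] ∈ H₁(Γ,ℤ)` of an oriented circuit. -/
def circChainZ (γ : Finset Γ.E) : Γ.E → ℤ :=
  fun e => if e ∈ γ then 1 else if Γ.inv e ∈ γ then -1 else 0

/-- The class `[γ] ∈ H₁(Γ,ℝ)` of an oriented circuit. -/
noncomputable def circChainR (γ : Finset Γ.E) : Γ.E → ℝ :=
  fun e => (Γ.circChainZ γ e : ℝ)

/-- `Cir_φ(Γ∖T)`: oriented circuits of `Γ∖T` compatibly oriented with the
orientation with positive edges `O`. -/
def Cir (T O : Set Γ.E) : Set (Finset Γ.E) :=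
  {γ | Γ.IsCircuit γ ∧ (∀ e ∈ γ, e ∈ O) ∧ ∀ e ∈ γ, e ∉ T}

/-- `c` is a 1-cycle: a skew 1-chain with vanishing boundary, i.e. an element of
`H₁(Γ,A)`. -/
def IsCycle {A : Type*} [AddCommGroup A] (c : Γ.E → A) : Prop :=
  (∀ e, c (Γ.inv e) = - c e) ∧
    ∀ v, ∑ e ∈ Finset.univ.filter (fun e => Γ.t e = v), c e = 0

/-- An element of `H₁(Γ∖T, A) ⊆ H₁(Γ,A)`: a cycle supported on edges not in `T`. -/
def IsCycleOn {A : Type*} [AddCommGroup A] (T : Set Γ.E) (c : Γ.E → A) : Prop :=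
  Γ.IsCycle c ∧ ∀ e ∈ T, c e = 0

/-- The standard positive definite bilinear form on `C⃗₁(Γ,ℝ)`, for which
`(c, e⃗) = c e`. -/
noncomputable def pair (c c' : Γ.E → ℝ) : ℝ := (∑ e, c e * c' e) / 2

/-- The first Betti number `b₁(Γ) = dim_ℝ H₁(Γ,ℝ)`. -/
noncomputable def b1 : ℕ :=
  Module.finrank ℝ (Submodule.span ℝ {c : Γ.E → ℝ | Γ.IsCycle c})

/-- `b₁(Γ∖T) = dim_ℝ H₁(Γ∖T,ℝ)`. -/
noncomputable def b1Sub (T : Set Γ.E) : ℕ :=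
  Module.finrank ℝ (Submodule.span ℝ {c : Γ.E → ℝ | Γ.IsCycleOn T c})

/-- The cone `σ(T,φ) ⊆ H₁(Γ,ℝ)` of the cographic fan associated to a pair
`(T, O)` with `O` an orientation of `Γ∖T`. -/
def sigmaCone (T O : Set Γ.E) : Set (Γ.E → ℝ) :=
  {v | Γ.IsCycle v ∧ (∀ e ∈ O, 0 ≤ v e) ∧ ∀ e ∈ T, v e = 0}

/-- The poset `OP_Γ` of totally cyclic orientations: pairs `(T, O)` with `T` a
set of unoriented edges and `O` a totally cyclic orientation of `Γ∖T`. -/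
def OP : Set (Set Γ.E × Set Γ.E) :=
  {p | Γ.InvClosed p.1 ∧ Γ.IsTotallyCyclic p.1 p.2}

/-- The order on `OP_Γ`: `(T',φ') ≤ (T,φ)` iff `T' ⊇ T` and `φ'` is the
restriction of `φ`. -/
def OPle (p q : Set Γ.E × Set Γ.E) : Prop :=
  q.1 ⊆ p.1 ∧ p.2 = q.2 ∩ p.1ᶜ

/-- `H₁(Γ,ℤ)` viewed as the set of lattice points of `H₁(Γ,ℝ)`. -/
def H1Z : Set (Γ.E → ℝ) := {c | Γ.IsCycle c ∧ ∀ e, ∃ n : ℤ, c e = (n : ℝ)}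

/-- The Voronoi polytope `Vor_Γ ⊆ H₁(Γ,ℝ)`. -/
def voronoi : Set (Γ.E → ℝ) :=
  {v | Γ.IsCycle v ∧ ∀ l ∈ Γ.H1Z, Γ.pair v v ≤ Γ.pair (v - l) (v - l)}

/-- A (exposed) face of the Voronoi polytope. -/
def IsVorFace (F : Set (Γ.E → ℝ)) : Prop :=
  ∃ l : (Γ.E → ℝ) →ₗ[ℝ] ℝ, F = {v | v ∈ Γ.voronoi ∧ ∀ w ∈ Γ.voronoi, l w ≤ l v}

/-- The face `F(T,φ)` of the Voronoi polytope associated to `(T,O) ∈ OP_Γ`. -/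
def vorFace (T O : Set Γ.E) : Set (Γ.E → ℝ) :=
  {v | v ∈ Γ.voronoi ∧ ∀ γ ∈ Γ.Cir T O,
      Γ.pair v (Γ.circChainR γ) = Γ.pair (Γ.circChainR γ) (Γ.circChainR γ) / 2}

end SerreGraph


namespace SerreGraph

variable {Γ : SerreGraph}

/-! ### The space of cycles and its bilinear form -/

/-- `H₁(Γ,ℝ)` as a subspace of the space of functions on oriented edges. -/
def cycles (Γ : SerreGraph) : Submodule ℝ (Γ.E → ℝ) where
  carrier := {c | Γ.IsCycle c}
  add_mem' := by
    rintro a b ⟨ha, ha'⟩ ⟨hb, hb'⟩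
    refine ⟨fun e => ?_, fun v => ?_⟩
    · simp only [Pi.add_apply, ha e, hb e]; ring
    · simp only [Pi.add_apply, Finset.sum_add_distrib, ha' v, hb' v, add_zero]
  zero_mem' := ⟨fun e => by simp, fun v => by simp⟩
  smul_mem' := by
    rintro r a ⟨ha, ha'⟩
    refine ⟨fun e => ?_, fun v => ?_⟩
    · simp only [Pi.smul_apply, ha e, smul_eq_mul]; ring
    · simp only [Pi.smul_apply, smul_eq_mul, ← Finset.mul_sum, ha' v, mul_zero]

theorem pair_comm (c d : Γ.E → ℝ) : Γ.pair c d = Γ.pair d c := by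
  simp only [pair, mul_comm]

theorem pair_add_left (a b d : Γ.E → ℝ) :
    Γ.pair (a + b) d = Γ.pair a d + Γ.pair b d := by
  simp only [pair, Pi.add_apply, add_mul, Finset.sum_add_distrib, add_div]

theorem pair_smul_left (r : ℝ) (a d : Γ.E → ℝ) :
    Γ.pair (r • a) d = r * Γ.pair a d := by
  simp only [pair, Pi.smul_apply, smul_eq_mul, mul_assoc, ← Finset.mul_sum, mul_div_assoc]

theorem pair_add_right (a b d : Γ.E → ℝ) :
    Γ.pair d (a + b) = Γ.pair d a + Γ.pair d b := by
  simp only [pair_comm d, pair_add_left]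

theorem pair_smul_right (r : ℝ) (a d : Γ.E → ℝ) :
    Γ.pair d (r • a) = r * Γ.pair d a := by
  simp only [pair_comm d, pair_smul_left]

theorem pair_zero_right (d : Γ.E → ℝ) : Γ.pair d 0 = 0 := by
  simp [pair]

theorem eq_zero_of_pair_self {c : Γ.E → ℝ} (h : Γ.pair c c = 0) : c = 0 := by
  have h' : ∑ e, c e * c e = 0 := by
    unfold pair at h; linarith
  rw [Finset.sum_eq_zero_iff_of_nonneg fun e _ => mul_self_nonneg (c e)] at h'
  funext e
  simpa using h' e (Finset.mem_univ e)

/-- `pair` as a bilinear map. -/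
noncomputable def pairBilin (Γ : SerreGraph) : (Γ.E → ℝ) →ₗ[ℝ] (Γ.E → ℝ) →ₗ[ℝ] ℝ :=
  LinearMap.mk₂ ℝ Γ.pair pair_add_left pair_smul_left
    (fun d a b => pair_add_right a b d) (fun r d a => pair_smul_right r a d)

/-- Every linear functional on `H₁(Γ,ℝ)` is represented by a cycle. -/
theorem exists_cycle_representing (l : (Γ.E → ℝ) →ₗ[ℝ] ℝ) :
    ∃ c, Γ.IsCycle c ∧ ∀ v, Γ.IsCycle v → l v = Γ.pair v c := by
  let B : Γ.cycles →ₗ[ℝ] Module.Dual ℝ Γ.cycles :=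
    Γ.pairBilin.domRestrict₁₂ Γ.cycles Γ.cycles
  have hB : Function.Injective B := by
    rw [← LinearMap.ker_eq_bot, LinearMap.ker_eq_bot']
    intro m hm
    have h := LinearMap.congr_fun hm m
    exact Subtype.ext (eq_zero_of_pair_self h)
  have hs : Function.Surjective B :=
    (LinearMap.injective_iff_surjective_of_finrank_eq_finrank
      Subspace.dual_finrank_eq.symm).1 hB
  obtain ⟨c, hc⟩ := hs (l.domRestrict Γ.cycles)
  refine ⟨c, c.2, fun v hv => ?_⟩
  have h := LinearMap.congr_fun hc ⟨v, hv⟩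
  rw [pair_comm]
  exact h.symm

/-- The `ℓ¹`-norm on 1-chains for which each unoriented edge has norm one. -/
noncomputable def l1Norm (c : Γ.E → ℝ) : ℝ := (∑ e, |c e|) / 2

theorem mem_voronoi_iff {v : Γ.E → ℝ} :
    v ∈ Γ.voronoi ↔ Γ.IsCycle v ∧ ∀ l ∈ Γ.H1Z, Γ.pair v l ≤ Γ.pair l l / 2 := by
  have key : ∀ l, Γ.pair (v - l) (v - l) = Γ.pair v v - 2 * Γ.pair v l + Γ.pair l l := by
    intro l
    have : v - l = v + (-1 : ℝ) • l := by simp [sub_eq_add_neg]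
    rw [this]
    simp only [pair_add_left, pair_add_right, pair_smul_left, pair_smul_right, pair_comm l v]
    ring
  refine and_congr_right fun _ => forall₂_congr fun l _ => ?_
  rw [key]
  constructor <;> intro h <;> linarith

/-! ### Circuits -/

theorem t_inv (e : Γ.E) : Γ.t (Γ.inv e) = Γ.s e := by
  rw [← Γ.s_inv, Γ.inv_inv]

/-- The reversal of edges as a permutation. -/
def invEquiv (Γ : SerreGraph) : Γ.E ≃ Γ.E := ⟨Γ.inv, Γ.inv, Γ.inv_inv, Γ.inv_inv⟩

theorem circChainR_of_mem {γ : Finset Γ.E} {e : Γ.E} (h : e ∈ γ) : Γ.circChainR γ e = 1 := by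
  simp [circChainR, circChainZ, h]

theorem circChainR_of_inv_mem {γ : Finset Γ.E} (hγ : Γ.IsCircuit γ) {e : Γ.E}
    (h : Γ.inv e ∈ γ) : Γ.circChainR γ e = -1 := by
  have : e ∉ γ := fun h' => hγ.2.1 e h' h
  simp [circChainR, circChainZ, h, this]

theorem circChainR_of_notMem {γ : Finset Γ.E} {e : Γ.E} (h : e ∉ γ) (h' : Γ.inv e ∉ γ) :
    Γ.circChainR γ e = 0 := by
  simp [circChainR, circChainZ, h, h']

theorem circChainR_eq_sub {γ : Finset Γ.E} (hγ : Γ.IsCircuit γ) (e : Γ.E) :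
    Γ.circChainR γ e = (if e ∈ γ then 1 else 0) - (if Γ.inv e ∈ γ then 1 else 0) := by
  by_cases h : e ∈ γ
  · simp [circChainR_of_mem h, h, hγ.2.1 e h]
  · by_cases h' : Γ.inv e ∈ γ
    · simp [circChainR_of_inv_mem hγ h', h, h']
    · simp [circChainR_of_notMem h h', h, h']

theorem isCycle_circChainR {γ : Finset Γ.E} (hγ : Γ.IsCircuit γ) :
    Γ.IsCycle (Γ.circChainR γ) := by
  refine ⟨fun e => ?_, fun v => ?_⟩
  · simp only [circChainR_eq_sub hγ, Γ.inv_inv]; ring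
  have h2 : ∑ e with Γ.t e = v, (if Γ.inv e ∈ γ then (1 : ℝ) else 0)
      = ∑ e with Γ.s e = v, (if e ∈ γ then (1 : ℝ) else 0) := by
    refine Finset.sum_equiv Γ.invEquiv (fun e => ?_) (fun e _ => rfl)
    simp [invEquiv, Γ.s_inv]
  simp only [circChainR_eq_sub hγ, Finset.sum_sub_distrib, h2]
  rw [sub_eq_zero, ← Finset.sum_filter, ← Finset.sum_filter]
  simp only [Finset.sum_const, nsmul_eq_mul, mul_one, Nat.cast_inj, Finset.filter_filter]
  by_cases hv : v ∈ γ.image Γ.s ∪ γ.image Γ.t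
  · obtain ⟨e, ⟨he, he'⟩, hu⟩ := hγ.2.2.1 v hv
    obtain ⟨f, ⟨hf, hf'⟩, hw⟩ := hγ.2.2.2.1 v hv
    have h3 : (Finset.univ.filter fun a => Γ.t a = v ∧ a ∈ γ) = {f} := by
      ext a
      simp only [Finset.mem_filter, Finset.mem_univ, true_and, Finset.mem_singleton]
      exact ⟨fun h => hw a ⟨h.2, h.1⟩, fun h => h ▸ ⟨hf', hf⟩⟩
    have h4 : (Finset.univ.filter fun a => Γ.s a = v ∧ a ∈ γ) = {e} := by
      ext a
      simp only [Finset.mem_filter, Finset.mem_univ, true_and, Finset.mem_singleton]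
      exact ⟨fun h => hu a ⟨h.2, h.1⟩, fun h => h ▸ ⟨he', he⟩⟩
    rw [h3, h4, Finset.card_singleton, Finset.card_singleton]
  · simp only [Finset.mem_union, Finset.mem_image, not_or, not_exists, not_and] at hv
    rw [Finset.filter_false_of_mem fun a _ h => hv.2 a h.2 h.1,
      Finset.filter_false_of_mem fun a _ h => hv.1 a h.2 h.1]

theorem circChainR_mem_H1Z {γ : Finset Γ.E} (hγ : Γ.IsCircuit γ) : Γ.circChainR γ ∈ Γ.H1Z :=
  ⟨isCycle_circChainR hγ, fun e => ⟨Γ.circChainZ γ e, rfl⟩⟩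

theorem pair_circChainR_self (γ : Finset Γ.E) :
    Γ.pair (Γ.circChainR γ) (Γ.circChainR γ) = l1Norm (Γ.circChainR γ) := by
  unfold pair l1Norm
  congr 1
  refine Finset.sum_congr rfl fun e _ => ?_
  unfold circChainR circChainZ
  split_ifs <;> simp

/-- A nonzero cycle contains an oriented circuit in its positive support. -/
theorem exists_isCircuit_of_ne_zero {c : Γ.E → ℝ} (hc : Γ.IsCycle c) (h0 : c ≠ 0) :
    ∃ γ, Γ.IsCircuit γ ∧ ∀ e ∈ γ, 0 < c e := by
  classical
  let Q : Finset Γ.E → Prop := fun γ =>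
    γ.Nonempty ∧ (∀ e ∈ γ, 0 < c e) ∧ ∀ e ∈ γ, ∃ f ∈ γ, Γ.s f = Γ.t e
  have hQ : Q (Finset.univ.filter fun e => 0 < c e) := by
    refine ⟨?_, by simp, ?_⟩
    · obtain ⟨e, he⟩ := Function.ne_iff.1 h0
      rcases lt_or_gt_of_ne he with h | h
      · refine ⟨Γ.inv e, ?_⟩
        simp only [Finset.mem_filter, Finset.mem_univ, true_and, hc.1 e]
        simpa using h
      · exact ⟨e, by simpa using h⟩
    · intro e he
      simp only [Finset.mem_filter, Finset.mem_univ, true_and] at he ⊢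
      by_contra! hcon
      refine (Finset.sum_pos' (s := Finset.univ.filter fun f => Γ.t f = Γ.t e) (f := c)
        (fun f hf => ?_) ⟨e, by simp, he⟩).ne' (hc.2 (Γ.t e))
      by_contra! hlt
      refine hcon (Γ.inv f) (by rw [hc.1 f]; linarith) ?_
      rw [Γ.s_inv]
      exact (Finset.mem_filter.1 hf).2
  obtain ⟨γ, hγ, hmin⟩ := (Finset.univ.filter Q).exists_min_image Finset.card ⟨_, by simpa using hQ⟩
  simp only [Finset.mem_filter, Finset.mem_univ, true_and] at hγ hmin
  obtain ⟨hne, hpos, hnext⟩ := hγ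
  have hsub : ∀ δ ⊆ γ, δ.Nonempty → (∀ e ∈ δ, ∃ f ∈ δ, Γ.s f = Γ.t e) → δ = γ :=
    fun δ hδ h1 h2 => Finset.eq_of_subset_of_card_le hδ
      (hmin δ ⟨h1, fun e he => hpos e (hδ he), h2⟩)
  have hs : ∀ e ∈ γ, ∀ f ∈ γ, Γ.s e = Γ.s f → e = f := by
    intro e he f hf hef
    by_contra hne'
    have := hsub (γ.erase f) (Finset.erase_subset _ _) ⟨e, Finset.mem_erase.2 ⟨hne', he⟩⟩ <| by
      intro a ha
      obtain ⟨b, hb, hba⟩ := hnext a (Finset.mem_of_mem_erase ha)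
      by_cases hbf : b = f
      · exact ⟨e, Finset.mem_erase.2 ⟨hne', he⟩, by rw [hef, ← hbf, hba]⟩
      · exact ⟨b, Finset.mem_erase.2 ⟨hbf, hb⟩, hba⟩
    rw [← this] at hf
    exact Finset.notMem_erase _ _ hf
  choose! next hnext_mem hnext_s using hnext
  have himage : γ.image next = γ := by
    refine hsub _ (Finset.image_subset_iff.2 hnext_mem) (hne.image _) fun e he => ?_
    obtain ⟨a, ha, rfl⟩ := Finset.mem_image.1 he
    exact ⟨next (next a), Finset.mem_image_of_mem _ (hnext_mem a ha),
      hnext_s _ (hnext_mem a ha)⟩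
  have hinj : Set.InjOn next γ := Finset.card_image_iff.1 (by rw [himage])
  have ht : ∀ e ∈ γ, ∀ f ∈ γ, Γ.t e = Γ.t f → e = f := fun e he f hf hef =>
    hinj he hf (hs _ (hnext_mem e he) _ (hnext_mem f hf) (by rw [hnext_s e he, hnext_s f hf, hef]))
  have hprev : ∀ e ∈ γ, ∃ f ∈ γ, Γ.t f = Γ.s e := by
    intro e he
    rw [← himage] at he
    obtain ⟨a, ha, rfl⟩ := Finset.mem_image.1 he
    exact ⟨a, ha, (hnext_s a ha).symm⟩
  refine ⟨γ, ⟨hne, ?_, ?_, ?_, ?_⟩, hpos⟩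
  · intro e he h
    have h1 := hpos e he
    have h2 := hpos _ h
    rw [hc.1 e] at h2
    linarith
  · intro v hv
    have : ∃ e ∈ γ, Γ.s e = v := by
      simp only [Finset.mem_union, Finset.mem_image] at hv
      rcases hv with h | ⟨e, he, rfl⟩
      · exact h
      · exact ⟨next e, hnext_mem e he, hnext_s e he⟩
    obtain ⟨e, he, rfl⟩ := this
    exact ⟨e, ⟨he, rfl⟩, fun f hf => hs f hf.1 e he hf.2⟩
  · intro v hv
    have : ∃ e ∈ γ, Γ.t e = v := by
      simp only [Finset.mem_union, Finset.mem_image] at hv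
      rcases hv with ⟨e, he, rfl⟩ | h
      · exact hprev e he
      · exact h
    obtain ⟨e, he, rfl⟩ := this
    exact ⟨e, ⟨he, rfl⟩, fun f hf => ht f hf.1 e he hf.2⟩
  · intro e he f hf
    have := hsub (γ.filter fun f => Γ.Reach ((↑γ : Set Γ.E) ∪ Γ.inv '' ↑γ) (Γ.s e) (Γ.s f))
      (Finset.filter_subset _ _) ⟨e, Finset.mem_filter.2 ⟨he, Relation.ReflTransGen.refl⟩⟩ <| by
      intro a ha
      obtain ⟨ha, har⟩ := Finset.mem_filter.1 ha
      exact ⟨next a, Finset.mem_filter.2 ⟨hnext_mem a ha,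
        har.tail ⟨a, Or.inl ha, rfl, (hnext_s a ha).symm⟩⟩, hnext_s a ha⟩
    rw [← this] at hf
    exact (Finset.mem_filter.1 hf).2

/-- Subtracting from a cycle the largest possible multiple of an oriented circuit contained in its
positive support. -/
theorem exists_sub_circuit {c : Γ.E → ℝ} (hc : Γ.IsCycle c) {γ : Finset Γ.E}
    (hγ : Γ.IsCircuit γ) (hpos : ∀ e ∈ γ, 0 < c e) :
    ∃ a : ℝ, 0 < a ∧ ∃ d, Γ.IsCycle d ∧ c = d + a • Γ.circChainR γ ∧
      l1Norm c = l1Norm d + a * l1Norm (Γ.circChainR γ) ∧ (∀ e, 0 < d e → 0 < c e) ∧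
      Function.support d ⊂ Function.support c := by
  obtain ⟨e₀, he₀, hmin⟩ := γ.exists_min_image c hγ.1
  have hcase : ∀ e, (e ∈ γ ∧ Γ.circChainR γ e = 1 ∧ c e₀ ≤ c e) ∨
      (Γ.inv e ∈ γ ∧ Γ.circChainR γ e = -1 ∧ c e₀ ≤ - c e) ∨ Γ.circChainR γ e = 0 := by
    intro e
    by_cases h : e ∈ γ
    · exact Or.inl ⟨h, circChainR_of_mem h, hmin e h⟩
    by_cases h' : Γ.inv e ∈ γ
    · exact Or.inr (Or.inl ⟨h', circChainR_of_inv_mem hγ h', hc.1 e ▸ hmin _ h'⟩)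
    · exact Or.inr (Or.inr (circChainR_of_notMem h h'))
  have h0 := hpos e₀ he₀
  have hd : ∀ e, (c + (-c e₀) • Γ.circChainR γ) e = c e - c e₀ * Γ.circChainR γ e := by
    intro e; simp [sub_eq_add_neg]
  refine ⟨c e₀, h0, c + (-c e₀) • Γ.circChainR γ, ?_, ?_, ?_, ?_, ?_⟩
  · exact Γ.cycles.add_mem hc (Γ.cycles.smul_mem _ (isCycle_circChainR hγ))
  · simp
  · unfold l1Norm
    rw [← mul_div_assoc, ← add_div, Finset.mul_sum, ← Finset.sum_add_distrib]
    congr 1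
    refine Finset.sum_congr rfl fun e _ => ?_
    rw [hd]
    rcases hcase e with ⟨-, h, h'⟩ | ⟨-, h, h'⟩ | h
    · rw [h, abs_of_nonneg (by linarith), abs_of_nonneg (by linarith), abs_one]; ring
    · rw [h, abs_of_nonpos (by linarith), abs_of_nonpos (by linarith), abs_neg, abs_one]; ring
    · simp [h]
  · intro e he
    rw [hd] at he
    rcases hcase e with ⟨-, h, h'⟩ | ⟨-, h, h'⟩ | h
    · linarith
    · rw [h] at he; linarith
    · simpa [h] using he
  · refine (Set.ssubset_iff_of_subset fun e he => ?_).2 ⟨e₀, h0.ne', ?_⟩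
    · rw [Function.mem_support, hd] at he
      rcases hcase e with ⟨-, h, h'⟩ | ⟨-, h, h'⟩ | h
      · exact (by linarith : 0 < c e).ne'
      · exact (by linarith : c e < 0).ne
      · simpa [h] using he
    · rw [Function.mem_support, hd, circChainR_of_mem he₀]; simp

/-- Induction over the decomposition of a cycle as a conformal positive combination of oriented
circuits. -/
theorem cycle_induction {P : (Γ.E → ℝ) → Prop} (zero : P 0)
    (step : ∀ (c d : Γ.E → ℝ) (a : ℝ) (γ : Finset Γ.E), Γ.IsCycle c → Γ.IsCircuit γ → 0 < a →
      (∀ e ∈ γ, 0 < c e) → (∀ e, 0 < d e → 0 < c e) → c = d + a • Γ.circChainR γ →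
      l1Norm c = l1Norm d + a * l1Norm (Γ.circChainR γ) → P d → P c)
    {c : Γ.E → ℝ} (hc : Γ.IsCycle c) : P c := by
  induction hn : (Function.support c).ncard using Nat.strong_induction_on generalizing c with
  | _ n ih =>
    by_cases h0 : c = 0
    · exact h0 ▸ zero
    obtain ⟨γ, hγ, hpos⟩ := exists_isCircuit_of_ne_zero hc h0
    obtain ⟨a, ha, d, hd, hcd, hnorm, hdc, hsupp⟩ := exists_sub_circuit hc hγ hpos
    exact step c d a γ hc hγ ha hpos hdc hcd hnorm
      (ih _ (hn ▸ Set.ncard_lt_ncard hsupp) hd rfl)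

/-! ### Faces of the Voronoi polytope defined by cycles -/

theorem pair_circChainR_le {v : Γ.E → ℝ} (hv : v ∈ Γ.voronoi) {γ : Finset Γ.E}
    (hγ : Γ.IsCircuit γ) : Γ.pair v (Γ.circChainR γ) ≤ l1Norm (Γ.circChainR γ) / 2 := by
  rw [← pair_circChainR_self]
  exact (mem_voronoi_iff.1 hv).2 _ (circChainR_mem_H1Z hγ)

theorem pair_le_of_mem_voronoi {v : Γ.E → ℝ} (hv : v ∈ Γ.voronoi) {c : Γ.E → ℝ}
    (hc : Γ.IsCycle c) : Γ.pair v c ≤ l1Norm c / 2 := by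
  refine cycle_induction (P := fun c => Γ.pair v c ≤ l1Norm c / 2) ?_ ?_ hc
  · simp [pair_zero_right, l1Norm]
  · intro c d a γ _ hγ ha _ _ hcd hnorm hd
    rw [hnorm, hcd, pair_add_right, pair_smul_right]
    have := mul_le_mul_of_nonneg_left (pair_circChainR_le hv hγ) ha.le
    linarith

theorem pair_eq_of_forall_circuit {v c : Γ.E → ℝ} (hc : Γ.IsCycle c)
    (hv : ∀ γ, Γ.IsCircuit γ → (∀ e ∈ γ, 0 < c e) →
      Γ.pair v (Γ.circChainR γ) = l1Norm (Γ.circChainR γ) / 2) :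
    Γ.pair v c = l1Norm c / 2 := by
  refine cycle_induction (P := fun c => (∀ γ, Γ.IsCircuit γ → (∀ e ∈ γ, 0 < c e) →
      Γ.pair v (Γ.circChainR γ) = l1Norm (Γ.circChainR γ) / 2) → Γ.pair v c = l1Norm c / 2)
    ?_ ?_ hc hv
  · simp [pair_zero_right, l1Norm]
  · intro c d a γ _ hγ _ hpos hdc hcd hnorm hd h
    rw [hnorm, hcd, pair_add_right, pair_smul_right, h γ hγ hpos,
      hd fun δ hδ hδ' => h δ hδ fun e he => hdc e (hδ' e he)]
    ring

/-- For `c` with zero set `T` and positive support `O`, membership in `F(T,O)` is detected by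
pairing with `c`. -/
theorem mem_vorFace_iff {c : Γ.E → ℝ} (hc : Γ.IsCycle c) {v : Γ.E → ℝ} :
    v ∈ Γ.vorFace {e | c e = 0} {e | 0 < c e} ↔
      v ∈ Γ.voronoi ∧ Γ.pair v c = l1Norm c / 2 := by
  refine and_congr_right fun hv => ⟨fun h => ?_, fun h γ hγ => ?_⟩
  · refine pair_eq_of_forall_circuit hc fun γ hγ hpos => ?_
    rw [h γ ⟨hγ, hpos, fun e he => (hpos e he).ne'⟩, pair_circChainR_self]
  · rw [pair_circChainR_self]
    obtain ⟨hγ, hpos, -⟩ := hγ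
    refine le_antisymm (pair_circChainR_le hv hγ) ?_
    obtain ⟨a, ha, d, hd, hcd, hnorm, -, -⟩ := exists_sub_circuit hc hγ hpos
    have h1 := pair_le_of_mem_voronoi hv hd
    rw [hnorm, hcd, pair_add_right, pair_smul_right] at h
    refine le_of_mul_le_mul_left ?_ ha
    linarith

theorem l1Norm_le_pair_self {l : Γ.E → ℝ} (hl : l ∈ Γ.H1Z) : l1Norm l ≤ Γ.pair l l := by
  unfold l1Norm pair
  gcongr with e
  obtain ⟨n, hn⟩ := hl.2 e
  rw [hn]
  have h : |n| ≤ n * n := by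
    rw [Int.abs_eq_natAbs, ← sq]
    exact Int.natAbs_le_self_sq n
  exact_mod_cast h

theorem sign_mul_le_abs (x y : ℝ) : Real.sign x * y ≤ |y| := by
  rcases Real.sign_apply_eq x with h | h | h <;> rw [h]
  · simpa using neg_le_abs y
  · simp
  · simpa using le_abs_self y

theorem sign_mul_self_eq_abs (x : ℝ) : Real.sign x * x = |x| := by
  rcases lt_trichotomy x 0 with h | h | h
  · rw [Real.sign_of_neg h, abs_of_neg h]; ring
  · simp [h]
  · rw [Real.sign_of_pos h, abs_of_pos h]; ring

/-- The orthogonal projection of half of the sign vector of `c` lies in the Voronoi polytope. -/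
theorem exists_mem_voronoi_sign (c : Γ.E → ℝ) :
    ∃ w ∈ Γ.voronoi, ∀ d, Γ.IsCycle d →
      Γ.pair w d = Γ.pair (fun e => Real.sign (c e)) d / 2 := by
  obtain ⟨w, hw, h⟩ :=
    exists_cycle_representing ((1 / 2 : ℝ) • Γ.pairBilin fun e => Real.sign (c e))
  have h' : ∀ d, Γ.IsCycle d → Γ.pair w d = Γ.pair (fun e => Real.sign (c e)) d / 2 := by
    intro d hd
    rw [pair_comm, ← h d hd]
    simp [pairBilin]
    ring
  refine ⟨w, mem_voronoi_iff.2 ⟨hw, fun l hl => ?_⟩, h'⟩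
  rw [h' l hl.1]
  gcongr
  refine le_trans ?_ (l1Norm_le_pair_self hl)
  unfold l1Norm pair
  gcongr
  exact sign_mul_le_abs _ _

theorem pair_sign_self (c : Γ.E → ℝ) : Γ.pair (fun e => Real.sign (c e)) c = l1Norm c := by
  simp only [pair, l1Norm, sign_mul_self_eq_abs]

theorem vorFace_eq_exposed {c : Γ.E → ℝ} (hc : Γ.IsCycle c) :
    Γ.vorFace {e | c e = 0} {e | 0 < c e} =
      {v | v ∈ Γ.voronoi ∧ ∀ w ∈ Γ.voronoi, Γ.pair w c ≤ Γ.pair v c} := by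
  ext v
  rw [mem_vorFace_iff hc]
  refine and_congr_right fun hv => ⟨fun h w hw => h ▸ pair_le_of_mem_voronoi hw hc, fun h => ?_⟩
  refine le_antisymm (pair_le_of_mem_voronoi hv hc) ?_
  obtain ⟨w, hw, hwc⟩ := exists_mem_voronoi_sign c
  rw [← pair_sign_self, ← hwc c hc]
  exact h w hw

/-! ### Totally cyclic orientations are the sign vectors of cycles -/

theorem sum_filter_t_mem {c : Γ.E → ℝ} (hc : Γ.IsCycle c) (W : Set Γ.V) [DecidablePred (· ∈ W)] :
    ∑ e with Γ.t e ∈ W, c e = 0 := by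
  rw [← Finset.sum_fiberwise_of_maps_to (s := Finset.univ.filter fun e => Γ.t e ∈ W)
    (t := Finset.univ.filter (· ∈ W)) (g := Γ.t) (fun e he => by simpa using he)]
  refine Finset.sum_eq_zero fun v hv => ?_
  rw [← hc.2 v, Finset.filter_filter]
  refine Finset.sum_congr (Finset.filter_congr fun e _ => ?_) fun _ _ => rfl
  simp only [Finset.mem_filter, Finset.mem_univ, true_and] at hv
  exact ⟨fun h => h.2, fun h => ⟨h ▸ hv, h⟩⟩

/-- The net flow of a cycle into a vertex set vanishes. -/
theorem sum_boundary_eq_zero {c : Γ.E → ℝ} (hc : Γ.IsCycle c) (W : Set Γ.V)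
    [DecidablePred (· ∈ W)] : ∑ e with Γ.t e ∈ W ∧ Γ.s e ∉ W, c e = 0 := by
  have h1 := sum_filter_t_mem hc W
  rw [← Finset.sum_filter_add_sum_filter_not _ (fun e => Γ.s e ∈ W), Finset.filter_filter,
    Finset.filter_filter] at h1
  have h2 : ∑ e with Γ.t e ∈ W ∧ Γ.s e ∈ W, c e = ∑ e with Γ.t e ∈ W ∧ Γ.s e ∈ W, - c e := by
    refine Finset.sum_equiv Γ.invEquiv (fun e => ?_) (fun e _ => ?_)
    · simp [invEquiv, Γ.s_inv, t_inv, and_comm]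
    · simp [invEquiv, hc.1]
  rw [Finset.sum_neg_distrib] at h2
  linarith

theorem sign_mem_OP {c : Γ.E → ℝ} (hc : Γ.IsCycle c) :
    (({e | c e = 0}, {e | 0 < c e}) : Set Γ.E × Set Γ.E) ∈ Γ.OP := by
  classical
  refine ⟨fun e => ?_, ⟨fun e he => he.ne', fun e he => ?_⟩, ?_⟩
  · simp [hc.1 e]
  · simp only [Set.mem_ofPred_eq, hc.1 e, not_lt] at he ⊢
    rw [Left.neg_nonpos_iff]
    exact ⟨le_of_lt, fun h => lt_of_le_of_ne h (Ne.symm he)⟩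
  · rintro ⟨W, ⟨v, hv, w, hw, hr⟩, hW⟩
    have hle : ∀ e ∈ Finset.univ.filter (fun e => Γ.t e ∈ W ∧ Γ.s e ∉ W), c e ≤ 0 := by
      intro e he
      simp only [Finset.mem_filter, Finset.mem_univ, true_and] at he
      by_contra! h
      exact he.2 (hW e h he.1)
    have hz := (Finset.sum_eq_zero_iff_of_nonpos hle).1 (sum_boundary_eq_zero hc W)
    refine hw ?_
    clear hw
    induction hr with
    | refl => exact hv
    | tail _ hab ih =>
      obtain ⟨e, he, rfl, rfl⟩ := hab
      by_contra hcon
      refine he ?_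
      have := hz (Γ.inv e) (by simpa [t_inv, Γ.s_inv] using ⟨ih, hcon⟩)
      simpa [hc.1 e] using this

/-- The skew 1-chain of a single oriented edge. -/
def edgeChain (e : Γ.E) : Γ.E → ℝ :=
  fun f => (if f = e then 1 else 0) - (if Γ.inv f = e then 1 else 0)

theorem edgeChain_inv (e f : Γ.E) : edgeChain e (Γ.inv f) = - edgeChain e f := by
  simp only [edgeChain, Γ.inv_inv]; ring

theorem sum_edgeChain (e : Γ.E) (v : Γ.V) :
    ∑ f with Γ.t f = v, edgeChain e f =
      (if Γ.t e = v then 1 else 0) - (if Γ.s e = v then 1 else 0) := by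
  have h2 : ∑ f with Γ.t f = v, (if Γ.inv f = e then (1 : ℝ) else 0)
      = ∑ f with Γ.s f = v, (if f = e then (1 : ℝ) else 0) := by
    refine Finset.sum_equiv Γ.invEquiv (fun f => ?_) (fun f _ => rfl)
    simp [invEquiv, Γ.s_inv]
  simp only [edgeChain, Finset.sum_sub_distrib, h2, Finset.sum_ite_eq', Finset.mem_filter,
    Finset.mem_univ, true_and]

section Orientation

variable {T O : Set Γ.E}

theorem inv_notMem_of_mem (hO : Γ.IsOrientation T O) {e : Γ.E} (he : e ∈ O) : Γ.inv e ∉ O :=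
  (hO.2 e (hO.1 e he)).1 he

theorem edgeChain_nonneg (hO : Γ.IsOrientation T O) {e f : Γ.E} (he : e ∈ O) (hf : f ∈ O) :
    0 ≤ edgeChain e f := by
  have : Γ.inv f ≠ e := fun h => inv_notMem_of_mem hO hf (h ▸ he)
  unfold edgeChain
  rw [if_neg this]
  split_ifs <;> norm_num

theorem edgeChain_eq_zero (hT : Γ.InvClosed T) (hO : Γ.IsOrientation T O) {e f : Γ.E}
    (he : e ∈ O) (hf : f ∈ T) : edgeChain e f = 0 := by
  have h1 : f ≠ e := fun h => hO.1 e he (h ▸ hf)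
  have h2 : Γ.inv f ≠ e := fun h => hO.1 e he (h ▸ (hT f).1 hf)
  simp [edgeChain, h1, h2]

theorem edgeChain_self (e : Γ.E) : edgeChain e e = 1 := by
  simp [edgeChain, Γ.inv_ne]

/-- A directed path in `O` yields a nonnegative chain with boundary `b - a`. -/
theorem exists_path_chain (hT : Γ.InvClosed T) (hO : Γ.IsOrientation T O) {a b : Γ.V}
    (h : Γ.Reach O a b) :
    ∃ x : Γ.E → ℝ, (∀ e, x (Γ.inv e) = - x e) ∧ (∀ e ∈ O, 0 ≤ x e) ∧ (∀ e ∈ T, x e = 0) ∧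
      ∀ v, ∑ f with Γ.t f = v, x f = (if b = v then 1 else 0) - (if a = v then 1 else 0) := by
  induction h with
  | refl => exact ⟨0, by simp, by simp, by simp, by simp⟩
  | tail _ hab ih =>
    obtain ⟨e, he, rfl, rfl⟩ := hab
    obtain ⟨x, h1, h2, h3, h4⟩ := ih
    refine ⟨x + edgeChain e, fun f => ?_, fun f hf => ?_, fun f hf => ?_, fun v => ?_⟩
    · simp only [Pi.add_apply, h1, edgeChain_inv]; ring
    · exact add_nonneg (h2 f hf) (edgeChain_nonneg hO he hf)
    · simp [h3 f hf, edgeChain_eq_zero hT hO he hf]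
    · simp only [Pi.add_apply, Finset.sum_add_distrib, h4, sum_edgeChain]; ring

/-- Every edge of a totally cyclic orientation lies in the support of a nonnegative cycle. -/
theorem exists_cycle_pos_at (hT : Γ.InvClosed T) (hO : Γ.IsTotallyCyclic T O) {e : Γ.E}
    (he : e ∈ O) :
    ∃ c : Γ.E → ℝ, Γ.IsCycle c ∧ (∀ f ∈ O, 0 ≤ c f) ∧ (∀ f ∈ T, c f = 0) ∧ 0 < c e := by
  have hr : Γ.Reach O (Γ.t e) (Γ.s e) := by
    by_contra hr
    refine hO.2 ⟨{v | Γ.Reach O v (Γ.s e)}, ⟨Γ.s e, Relation.ReflTransGen.refl, Γ.t e, hr,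
      Relation.ReflTransGen.single ⟨e, hO.1.1 e he, rfl, rfl⟩⟩, fun f hf h => ?_⟩
    exact Relation.ReflTransGen.head ⟨f, hf, rfl, rfl⟩ h
  obtain ⟨x, h1, h2, h3, h4⟩ := exists_path_chain hT hO.1 hr
  refine ⟨x + edgeChain e, ⟨fun f => ?_, fun v => ?_⟩, fun f hf => ?_, fun f hf => ?_, ?_⟩
  · simp only [Pi.add_apply, h1, edgeChain_inv]; ring
  · simp only [Pi.add_apply, Finset.sum_add_distrib, h4, sum_edgeChain]; ring
  · exact add_nonneg (h2 f hf) (edgeChain_nonneg hO.1 he hf)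
  · simp [h3 f hf, edgeChain_eq_zero hT hO.1 he hf]
  · rw [Pi.add_apply, edgeChain_self]
    linarith [h2 e he]

end Orientation

/-- Every element of `OP_Γ` is the sign vector of a cycle. -/
theorem exists_cycle_of_mem_OP {p : Set Γ.E × Set Γ.E} (hp : p ∈ Γ.OP) :
    ∃ c : Γ.E → ℝ, Γ.IsCycle c ∧ p = ({e | c e = 0}, {e | 0 < c e}) := by
  classical
  obtain ⟨T, O⟩ := p
  obtain ⟨hT, hO⟩ : Γ.InvClosed T ∧ Γ.IsTotallyCyclic T O := hp
  choose! x hx hnonneg hzero hpos using fun e (he : e ∈ O) => exists_cycle_pos_at hT hO he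
  let c : Γ.E → ℝ := ∑ e with e ∈ O, x e
  have hc : Γ.IsCycle c := Γ.cycles.sum_mem fun e he => hx e (by simpa using he)
  have hcO : ∀ e ∈ O, 0 < c e := by
    intro e he
    simp only [c, Finset.sum_apply]
    exact Finset.sum_pos' (fun f hf => hnonneg f (by simpa using hf) e he)
      ⟨e, by simpa using he, hpos e he⟩
  have hcT : ∀ e ∈ T, c e = 0 := by
    intro e he
    simp only [c, Finset.sum_apply]
    exact Finset.sum_eq_zero fun f hf => hzero f (by simpa using hf) e he
  have hneg : ∀ e, e ∉ T → e ∉ O → c e < 0 := by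
    intro e heT heO
    have h : Γ.inv e ∈ O := by
      by_contra h
      exact heO ((hO.1.2 e heT).2 h)
    have := hcO _ h
    rw [hc.1 e] at this
    linarith
  refine ⟨c, hc, Prod.ext (Set.ext fun e => ⟨hcT e, fun h => ?_⟩)
    (Set.ext fun e => ⟨hcO e, fun h => ?_⟩)⟩
  · by_contra heT
    by_cases heO : e ∈ O
    · exact (hcO e heO).ne' h
    · exact (hneg e heT heO).ne h
  · by_contra heO
    by_cases heT : e ∈ T
    · exact (lt_irrefl (0 : ℝ)) ((hcT e heT) ▸ h)
    · exact lt_asymm (hneg e heT heO) h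

/-! ### The order on `OP_Γ` -/

theorem vorFace_subset_of_OPle {p q : Set Γ.E × Set Γ.E} (h : Γ.OPle p q) :
    Γ.vorFace q.1 q.2 ⊆ Γ.vorFace p.1 p.2 := by
  rintro v ⟨hv, hq⟩
  refine ⟨hv, fun γ hγ => hq γ ⟨hγ.1, fun e he => ?_, fun e he he' => hγ.2.2 e he (h.1 he')⟩⟩
  have := hγ.2.1 e he
  rw [h.2] at this
  exact this.1

theorem OPle_of_vorFace_subset {p q : Set Γ.E × Set Γ.E} (hp : p ∈ Γ.OP) (hq : q ∈ Γ.OP)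
    (h : Γ.vorFace q.1 q.2 ⊆ Γ.vorFace p.1 p.2) : Γ.OPle p q := by
  obtain ⟨c, hc, rfl⟩ := exists_cycle_of_mem_OP hp
  obtain ⟨d, hd, rfl⟩ := exists_cycle_of_mem_OP hq
  obtain ⟨w, hw, hwd⟩ := exists_mem_voronoi_sign d
  have h1 : w ∈ Γ.vorFace {e | d e = 0} {e | 0 < d e} :=
    (mem_vorFace_iff hd).2 ⟨hw, by rw [hwd d hd, pair_sign_self]⟩
  have h2 := ((mem_vorFace_iff hc).1 (h h1)).2
  have h3 : ∑ e, Real.sign (d e) * c e = ∑ e, |c e| := by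
    rw [hwd c hc] at h2
    unfold pair l1Norm at h2
    linarith
  have h4 : ∀ e, Real.sign (d e) * c e = |c e| := fun e =>
    (Finset.sum_eq_sum_iff_of_le fun e _ => sign_mul_le_abs (d e) (c e)).1 h3 e
      (Finset.mem_univ e)
  have hpos : ∀ e, 0 < c e → 0 < d e := by
    intro e he
    have := h4 e
    rw [abs_of_pos he] at this
    by_contra! hle
    rcases hle.lt_or_eq with hlt | heq
    · rw [Real.sign_of_neg hlt] at this; linarith
    · rw [heq, Real.sign_zero] at this; linarith
  have hneg : ∀ e, c e < 0 → d e < 0 := by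
    intro e he
    have := hpos (Γ.inv e) (by rw [hc.1 e]; linarith)
    rw [hd.1 e] at this
    linarith
  refine ⟨fun e he => ?_, Set.ext fun e => ⟨fun he => ⟨hpos e he, he.ne'⟩, fun he => ?_⟩⟩
  · by_contra hne
    rcases lt_or_gt_of_ne hne with hlt | hgt
    · exact (hneg e hlt).ne he
    · exact (hpos e hgt).ne' he
  · rcases lt_or_gt_of_ne he.2 with hlt | hgt
    · exact absurd he.1 (lt_asymm (hneg e hlt))
    · exact hgt

theorem OPle_antisymm {p q : Set Γ.E × Set Γ.E} (hq : q ∈ Γ.OP)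
    (h : Γ.OPle p q) (h' : Γ.OPle q p) : p = q := by
  have h1 : p.1 = q.1 := h'.1.antisymm h.1
  refine Prod.ext h1 ?_
  rw [h.2, h1, Set.inter_eq_left]
  exact fun e he => hq.2.1.1 e he

end SerreGraph

/-- `(T,φ) ↦ F(T,φ)` is a bijection from `OP_Γ` onto the set
of faces of the Voronoi polytope, and `(T,φ) ≤ (T',φ')` iff
`F(T,φ) ⊇ F(T',φ')`: `OP_Γ` is isomorphic to the poset of faces of `Vor_Γ`
ordered by reverse inclusion. -/
theorem stmt13 (Γ : SerreGraph) :
    (∀ p ∈ Γ.OP, Γ.IsVorFace (Γ.vorFace p.1 p.2)) ∧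
    (∀ F : Set (Γ.E → ℝ), Γ.IsVorFace F → ∃ p ∈ Γ.OP, F = Γ.vorFace p.1 p.2) ∧
    (∀ p ∈ Γ.OP, ∀ q ∈ Γ.OP, Γ.vorFace p.1 p.2 = Γ.vorFace q.1 q.2 → p = q) ∧
    ∀ p ∈ Γ.OP, ∀ q ∈ Γ.OP,
      (Γ.OPle p q ↔ Γ.vorFace q.1 q.2 ⊆ Γ.vorFace p.1 p.2) := by
  refine ⟨fun p hp => ?_, fun F hF => ?_, fun p hp q hq h => ?_, fun p hp q hq =>
    ⟨SerreGraph.vorFace_subset_of_OPle, SerreGraph.OPle_of_vorFace_subset hp hq⟩⟩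
  · obtain ⟨c, hc, rfl⟩ := SerreGraph.exists_cycle_of_mem_OP hp
    refine ⟨Γ.pairBilin c, ?_⟩
    simp only [SerreGraph.vorFace_eq_exposed hc, SerreGraph.pairBilin, LinearMap.mk₂_apply,
      SerreGraph.pair_comm c]
  · obtain ⟨l, rfl⟩ := hF
    obtain ⟨c, hc, hl⟩ := SerreGraph.exists_cycle_representing l
    refine ⟨_, SerreGraph.sign_mem_OP hc, ?_⟩
    rw [SerreGraph.vorFace_eq_exposed hc]
    ext v
    refine and_congr_right fun hv => forall₂_congr fun w hw => ?_
    rw [hl v hv.1, hl w hw.1]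
  · exact SerreGraph.OPle_antisymm hq (SerreGraph.OPle_of_vorFace_subset hp hq h.ge)
      (SerreGraph.OPle_of_vorFace_subset hq hp h.le)
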